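/- Taking q(k,z) ≡ i·0⁺ (limit of q = iε as ε → 0⁺) in the Nevanlinna formula ε^{-1} = 1 + ω_p²(z+q)/(z(z²−ω₂²)+q(z²−ω₁²)), the boundary value −Im ε^{-1}(k,ω+i0)/ω converges (as a distribution in ω) to π C₀ [((ω₂²−ω₁²)/ω₂²)δ(ω) + (ω₁²/(2ω₂²))(δ(ω−ω₂)+δ(ω+ω₂))]. -/

import Mathlib

open Filter MeasureTheory Complex

theorem integral_univ_inv_mul_sq_add_sq {p b : ℝ} (hp : p ≠ 0) (hb : b ≠ 0) :
    ∫ t : ℝ, ((t * p) ^ 2 + b ^ 2)⁻¹ = Real.pi / |p * b| := by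
  have hscale : ∀ t : ℝ, ((t * p) ^ 2 + b ^ 2)⁻¹ = (b ^ 2)⁻¹ * (1 + (p / b * t) ^ 2)⁻¹ := by
    intro t
    rw [← mul_inv]
    congr 1
    field_simp
    ring
  simp_rw [hscale]
  rw [integral_const_mul, Measure.integral_comp_mul_left (fun t : ℝ => (1 + t ^ 2)⁻¹) (p / b),
    integral_univ_inv_one_add_sq, smul_eq_mul, inv_div, abs_div, abs_mul, ← sq_abs b]
  have := abs_pos.mpr hp
  have := abs_pos.mpr hb
  field_simp

/-- The kernels `ε / (((x - a) h(x))² + ε² B(x)²)`, restricted to a neighbourhood `S` of `a` on which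
`h` is bounded away from zero, converge to `π / |h(a) B(a)|` times the Dirac mass at `a`. -/
theorem tendsto_setIntegral_lorentzian {h B φ : ℝ → ℝ} {S : Set ℝ} {a m M : ℝ}
    (hh : Continuous h) (hB : Continuous B) (hφ : Continuous φ) (hM : ∀ x, |φ x| ≤ M)
    (hS : MeasurableSet S) (ha : S ∈ nhds a) (hm : 0 < m) (hmh : ∀ x ∈ S, m ≤ |h x|)
    (hBa : B a ≠ 0) :
    Tendsto (fun ε : ℝ => ∫ x in S, ε / (((x - a) * h x) ^ 2 + ε ^ 2 * B x ^ 2) * φ x)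
      (nhdsWithin 0 (Set.Ioi 0)) (nhds (Real.pi / |h a * B a| * φ a)) := by
  have hM0 : 0 ≤ M := (abs_nonneg _).trans (hM a)
  have hha : h a ≠ 0 := abs_pos.mp (hm.trans_le (hmh a (mem_of_mem_nhds ha)))
  have hrescale : ∀ ε : ℝ, 0 < ε →
      ∫ t : ℝ, ((t * h (a + ε * t)) ^ 2 + B (a + ε * t) ^ 2)⁻¹ * S.indicator φ (a + ε * t)
        = ∫ x in S, ε / (((x - a) * h x) ^ 2 + ε ^ 2 * B x ^ 2) * φ x := by
    intro ε hε
    have hpt : ∀ t : ℝ,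
        ((t * h (a + ε * t)) ^ 2 + B (a + ε * t) ^ 2)⁻¹ * S.indicator φ (a + ε * t)
        = ε * (fun y : ℝ => S.indicator
            (fun x => ε / (((x - a) * h x) ^ 2 + ε ^ 2 * B x ^ 2) * φ x) (a + y)) (ε * t) := by
      intro t
      by_cases hx : a + ε * t ∈ S
      · simp only [Set.indicator_of_mem hx]
        have : ((a + ε * t - a) * h (a + ε * t)) ^ 2 + ε ^ 2 * B (a + ε * t) ^ 2
            = ε ^ 2 * ((t * h (a + ε * t)) ^ 2 + B (a + ε * t) ^ 2) := by ring
        rw [this, div_eq_mul_inv, mul_inv]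
        field_simp
      · simp [Set.indicator_of_notMem hx]
    simp_rw [hpt]
    rw [integral_const_mul, Measure.integral_comp_mul_left (fun y : ℝ => S.indicator
      (fun x => ε / (((x - a) * h x) ^ 2 + ε ^ 2 * B x ^ 2) * φ x) (a + y)) ε,
      integral_add_left_eq_self (S.indicator
      (fun x => ε / (((x - a) * h x) ^ 2 + ε ^ 2 * B x ^ 2) * φ x)) a, integral_indicator hS,
      smul_eq_mul, abs_of_pos (inv_pos.mpr hε), mul_inv_cancel_left₀ hε.ne']
  have hlim : Real.pi / |h a * B a| * φ a = ∫ t : ℝ, ((t * h a) ^ 2 + B a ^ 2)⁻¹ * φ a := by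
    rw [integral_mul_const, integral_univ_inv_mul_sq_add_sq hha hBa]
  rw [hlim]
  refine Tendsto.congr' (eventually_nhdsWithin_of_forall hrescale) ?_
  obtain ⟨δ, hδ, hδB⟩ : ∃ δ > 0, ∀ x, |x - a| < δ → |B a| / 2 < |B x| := by
    have hnear : ∀ᶠ x in nhds a, |B a| / 2 < |B x| :=
      hB.abs.continuousAt.eventually_const_lt (half_lt_self (abs_pos.mpr hBa))
    obtain ⟨δ, hδ, hball⟩ := Metric.eventually_nhds_iff.mp hnear
    exact ⟨δ, hδ, fun x hx => hball (by rwa [Real.dist_eq])⟩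
  set b := |B a| / 2 with hb
  have hb0 : 0 < b := half_pos (abs_pos.mpr hBa)
  obtain ⟨c, hc, hcm, hcb, hcδ⟩ :
      ∃ c > 0, c ≤ m ^ 2 ∧ c ≤ b ^ 2 ∧ c ≤ m ^ 2 * δ ^ 2 / (1 + δ ^ 2) :=
    ⟨min (m ^ 2) (min (b ^ 2) (m ^ 2 * δ ^ 2 / (1 + δ ^ 2))), by positivity, min_le_left _ _,
      (min_le_right _ _).trans (min_le_left _ _), (min_le_right _ _).trans (min_le_right _ _)⟩
  have hlower : ∀ ε t : ℝ, 0 < ε → ε < 1 → a + ε * t ∈ S →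
      c * (1 + t ^ 2) ≤ (t * h (a + ε * t)) ^ 2 + B (a + ε * t) ^ 2 := by
    intro ε t hε hε1 hx
    have hm2 : m ^ 2 ≤ h (a + ε * t) ^ 2 := by
      rw [← sq_abs (h _)]
      exact pow_le_pow_left₀ hm.le (hmh _ hx) 2
    have hth : m ^ 2 * t ^ 2 ≤ (t * h (a + ε * t)) ^ 2 := by
      rw [mul_pow, mul_comm]
      exact mul_le_mul_of_nonneg_left hm2 (sq_nonneg t)
    by_cases hnear : |a + ε * t - a| < δ
    · have hB2 : b ^ 2 ≤ B (a + ε * t) ^ 2 := by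
        rw [← sq_abs (B _)]
        exact pow_le_pow_left₀ hb0.le (hδB _ hnear).le 2
      nlinarith [mul_le_mul_of_nonneg_right hcm (sq_nonneg t)]
    · rw [add_sub_cancel_left, not_lt, abs_mul, abs_of_pos hε] at hnear
      have hδt : δ ≤ |t| := hnear.trans (mul_le_of_le_one_left (abs_nonneg t) hε1.le)
      have hδt2 : δ ^ 2 ≤ t ^ 2 := by
        rw [← sq_abs t]
        exact pow_le_pow_left₀ hδ.le hδt 2
      have hfar : m ^ 2 * δ ^ 2 / (1 + δ ^ 2) * (1 + t ^ 2) ≤ m ^ 2 * t ^ 2 := by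
        rw [div_mul_eq_mul_div, div_le_iff₀ (by positivity)]
        nlinarith [mul_le_mul_of_nonneg_left hδt2 (sq_nonneg m)]
      have := mul_le_mul_of_nonneg_right hcδ (by positivity : 0 ≤ 1 + t ^ 2)
      nlinarith [sq_nonneg (B (a + ε * t))]
  refine tendsto_integral_filter_of_dominated_convergence
    (fun t => c⁻¹ * (1 + t ^ 2)⁻¹ * M) ?_ ?_ ?_ ?_
  · refine Eventually.of_forall fun ε => Measurable.aestronglyMeasurable ?_
    exact Measurable.mul (by fun_prop) ((hφ.measurable.indicator hS).comp (by fun_prop))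
  · filter_upwards [Ioo_mem_nhdsGT (zero_lt_one' ℝ)] with ε hε
    refine Eventually.of_forall fun t => ?_
    by_cases hx : a + ε * t ∈ S
    · rw [Set.indicator_of_mem hx, Real.norm_eq_abs, abs_mul, ← mul_inv]
      refine mul_le_mul ?_ (hM _) (abs_nonneg _) (by positivity)
      rw [abs_of_nonneg (by positivity)]
      exact inv_anti₀ (by positivity) (hlower ε t hε.1 hε.2 hx)
    · rw [Set.indicator_of_notMem hx, mul_zero, norm_zero]
      positivity
  · exact (integrable_inv_one_add_sq.const_mul _).mul_const _
  · refine Eventually.of_forall fun t => ?_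
    have hx : Tendsto (fun ε : ℝ => a + ε * t) (nhdsWithin 0 (Set.Ioi 0)) (nhds a) := by
      have : Continuous fun ε : ℝ => a + ε * t := by fun_prop
      simpa using (this.tendsto 0).mono_left nhdsWithin_le_nhds
    have hind : Tendsto (fun ε : ℝ => S.indicator φ (a + ε * t))
        (nhdsWithin 0 (Set.Ioi 0)) (nhds (φ a)) := by
      refine Tendsto.congr' ?_ ((hφ.tendsto a).comp hx)
      filter_upwards [hx.eventually ha] with ε hε
      exact (Set.indicator_of_mem hε φ).symm
    refine Tendsto.mul (Tendsto.inv₀ ?_ (by positivity)) hind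
    exact ((((hh.tendsto a).comp hx).const_mul t).pow 2).add (((hB.tendsto a).comp hx).pow 2)

/-- The loss function of the Nevanlinna formula with parameter `q = iε`. -/
theorem neg_im_nevanlinna_div (ωp ω1 ω2 ε ω : ℝ) (hω : ω ≠ 0) :
    -(1 + (ωp : ℂ) ^ 2 * ((ω : ℂ) + I * (ε : ℂ))
        / ((ω : ℂ) * ((ω : ℂ) ^ 2 - (ω2 : ℂ) ^ 2)
            + I * (ε : ℂ) * ((ω : ℂ) ^ 2 - (ω1 : ℂ) ^ 2))).im / ω
      = ωp ^ 2 * (ω2 ^ 2 - ω1 ^ 2) *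
        (ε / ((ω * (ω ^ 2 - ω2 ^ 2)) ^ 2 + ε ^ 2 * (ω ^ 2 - ω1 ^ 2) ^ 2)) := by
  have hnum : (ωp : ℂ) ^ 2 * ((ω : ℂ) + I * (ε : ℂ)) = ⟨ωp ^ 2 * ω, ωp ^ 2 * ε⟩ := by
    apply Complex.ext <;> simp [← ofReal_pow]
  have hden : (ω : ℂ) * ((ω : ℂ) ^ 2 - (ω2 : ℂ) ^ 2) + I * (ε : ℂ) * ((ω : ℂ) ^ 2 - (ω1 : ℂ) ^ 2)
      = ⟨ω * (ω ^ 2 - ω2 ^ 2), ε * (ω ^ 2 - ω1 ^ 2)⟩ := by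
    apply Complex.ext <;> simp [← ofReal_pow]
  rw [hnum, hden, add_im, one_im, zero_add, div_im, normSq_mk]
  have hsq : ω * (ω ^ 2 - ω2 ^ 2) * (ω * (ω ^ 2 - ω2 ^ 2))
      + ε * (ω ^ 2 - ω1 ^ 2) * (ε * (ω ^ 2 - ω1 ^ 2))
      = (ω * (ω ^ 2 - ω2 ^ 2)) ^ 2 + ε ^ 2 * (ω ^ 2 - ω1 ^ 2) ^ 2 := by ring
  rw [hsq, ← sub_div, ← neg_div, div_right_comm, ← mul_div_assoc]
  congr 1
  field_simp
  ring

/-- Taking q = iε with ε → 0⁺ in the Nevanlinna formula, the loss function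
−Im ε⁻¹(ω)/ω converges, as a distribution, to the canonical three-delta
solution π C₀ [((ω₂²−ω₁²)/ω₂²) δ(ω) + (ω₁²/(2ω₂²)) (δ(ω−ω₂)+δ(ω+ω₂))]. -/
theorem nevanlinna_canonical_limit
    (C0 ωp ω1 ω2 : ℝ) (hC0 : 0 < C0) (hω1 : 0 < ω1) (hω12 : ω1 < ω2)
    (hωp : ωp ^ 2 = C0 * ω1 ^ 2)
    (εinv : ℝ → ℝ → ℂ)
    (hεinv : εinv = fun (ε ω : ℝ) =>
      1 + (ωp : ℂ) ^ 2 * ((ω : ℂ) + I * (ε : ℂ))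
        / ((ω : ℂ) * ((ω : ℂ) ^ 2 - (ω2 : ℂ) ^ 2)
            + I * (ε : ℂ) * ((ω : ℂ) ^ 2 - (ω1 : ℂ) ^ 2))) :
    ∀ φ : ℝ → ℝ, Continuous φ → HasCompactSupport φ →
      Tendsto (fun ε : ℝ => ∫ ω : ℝ, (-(εinv ε ω).im / ω) * φ ω)
        (nhdsWithin 0 (Set.Ioi 0))
        (nhds (Real.pi * C0 * (((ω2 ^ 2 - ω1 ^ 2) / ω2 ^ 2) * φ 0
            + (ω1 ^ 2 / (2 * ω2 ^ 2)) * (φ ω2 + φ (-ω2))))) := by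
  intro φ hφ hφc
  subst hεinv
  obtain ⟨M, hM⟩ := hφ.bounded_above_of_compact_support hφc
  have hω2 : 0 < ω2 := hω1.trans hω12
  have hgap : 0 < ω2 ^ 2 - ω1 ^ 2 := by nlinarith
  set B : ℝ → ℝ := fun ω => ω ^ 2 - ω1 ^ 2 with hBdef
  have hB : Continuous B := by fun_prop
  set K : ℝ → ℝ → ℝ := fun ε ω =>
    ε / ((ω * (ω ^ 2 - ω2 ^ 2)) ^ 2 + ε ^ 2 * B ω ^ 2) * φ ω with hK
  have hright := tendsto_setIntegral_lorentzian (h := fun ω => ω * (ω + ω2)) (B := B)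
    (S := Set.Ioi ω1) (a := ω2) (m := ω1 * ω2) (by fun_prop) hB hφ hM measurableSet_Ioi
    (Ioi_mem_nhds hω12) (by positivity)
    (fun x hx => by
      have hx : ω1 < x := hx
      refine le_trans ?_ (le_abs_self _)
      nlinarith)
    hgap.ne'
  have hleft := tendsto_setIntegral_lorentzian (h := fun ω => ω * (ω - ω2)) (B := B)
    (S := Set.Iic (-ω1)) (a := -ω2) (m := ω1 * ω2) (by fun_prop) hB hφ hM measurableSet_Iic
    (Iic_mem_nhds (neg_lt_neg hω12)) (by positivity)
    (fun x hx => by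
      have hx : x ≤ -ω1 := hx
      refine le_trans ?_ (le_abs_self _)
      nlinarith)
    (by simpa [hBdef] using hgap.ne')
  have hmid := tendsto_setIntegral_lorentzian (h := fun ω => ω ^ 2 - ω2 ^ 2) (B := B)
    (S := Set.Ioc (-ω1) ω1) (a := 0) (m := ω2 ^ 2 - ω1 ^ 2) (by fun_prop) hB hφ hM
    measurableSet_Ioc (Ioc_mem_nhds (neg_lt_zero.mpr hω1) hω1) hgap
    (fun x hx => by
      obtain ⟨hx1, hx2⟩ := hx
      refine le_trans ?_ (neg_le_abs _)
      nlinarith)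
    (by simpa [hBdef] using hω1.ne')
  have hint : ∀ ε : ℝ, 0 < ε → Integrable (K ε) := by
    intro ε hε
    refine Continuous.integrable_of_hasCompactSupport ?_ hφc.mul_left
    refine Continuous.mul (Continuous.div (by fun_prop) (by fun_prop) fun ω hzero => ?_) hφ
    have hBω : B ω = 0 := by
      have : ε ^ 2 * B ω ^ 2 = 0 := by
        nlinarith [sq_nonneg (ω * (ω ^ 2 - ω2 ^ 2)),
          mul_nonneg (sq_nonneg ε) (sq_nonneg (B ω))]
      simpa [hε.ne'] using this
    have hAω : ω * (ω ^ 2 - ω2 ^ 2) = 0 := by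
      rw [hBω] at hzero
      simpa using hzero
    have hBω' : ω ^ 2 = ω1 ^ 2 := sub_eq_zero.mp hBω
    rcases mul_eq_zero.mp hAω with h0 | h0
    · rw [h0] at hBω'
      nlinarith
    · linarith
  have hsum := ((hleft.add hmid).add hright).const_mul (ωp ^ 2 * (ω2 ^ 2 - ω1 ^ 2))
  convert Tendsto.congr' ?_ hsum using 2
  · have e1 : |-ω2 * (-ω2 - ω2) * B (-ω2)| = 2 * ω2 ^ 2 * (ω2 ^ 2 - ω1 ^ 2) := by
      rw [abs_of_nonneg] <;> simp only [hBdef, neg_sq]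
      · ring
      · have : -ω2 * (-ω2 - ω2) = 2 * ω2 ^ 2 := by ring
        rw [this]
        positivity
    have e2 : |((0 : ℝ) ^ 2 - ω2 ^ 2) * B 0| = ω2 ^ 2 * ω1 ^ 2 := by
      have : ((0 : ℝ) ^ 2 - ω2 ^ 2) * B 0 = ω2 ^ 2 * ω1 ^ 2 := by
        simp only [hBdef]
        ring
      rw [this, abs_of_nonneg (by positivity)]
    have e3 : |ω2 * (ω2 + ω2) * B ω2| = 2 * ω2 ^ 2 * (ω2 ^ 2 - ω1 ^ 2) := by
      rw [abs_of_nonneg (by positivity)]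
      ring
    rw [e1, e2, e3, hωp]
    have := hgap.ne'
    field_simp
    ring
  · filter_upwards [self_mem_nhdsWithin] with ε hε
    have hsplit : ∫ ω, K ε ω = (∫ ω in Set.Iic (-ω1), K ε ω)
        + (∫ ω in Set.Ioc (-ω1) ω1, K ε ω) + ∫ ω in Set.Ioi ω1, K ε ω := by
      rw [← setIntegral_union (Set.Iic_disjoint_Ioc le_rfl) measurableSet_Ioc
        (hint ε hε).integrableOn (hint ε hε).integrableOn,
        Set.Iic_union_Ioc_eq_Iic (by linarith), intervalIntegral.integral_Iic_add_Ioi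
        (hint ε hε).integrableOn (hint ε hε).integrableOn]
    have hae : ∫ ω : ℝ, (-(1 + (ωp : ℂ) ^ 2 * ((ω : ℂ) + I * (ε : ℂ))
        / ((ω : ℂ) * ((ω : ℂ) ^ 2 - (ω2 : ℂ) ^ 2)
            + I * (ε : ℂ) * ((ω : ℂ) ^ 2 - (ω1 : ℂ) ^ 2))).im / ω) * φ ω
        = ∫ ω, ωp ^ 2 * (ω2 ^ 2 - ω1 ^ 2) * K ε ω := by
      refine integral_congr_ae ?_
      filter_upwards [Measure.ae_ne volume (0 : ℝ)] with ω hω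
      rw [neg_im_nevanlinna_div ωp ω1 ω2 ε ω hω, mul_assoc]
    rw [hae, integral_const_mul, hsplit]
    have hfactor_left : ∀ ω : ℝ, (ω - -ω2) * (ω * (ω - ω2)) = ω * (ω ^ 2 - ω2 ^ 2) :=
      fun ω => by ring
    have hfactor_right : ∀ ω : ℝ, (ω - ω2) * (ω * (ω + ω2)) = ω * (ω ^ 2 - ω2 ^ 2) :=
      fun ω => by ring
    simp only [hfactor_left, hfactor_right, sub_zero, hK]
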